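/- Let p < 0 and define Φ_p(X) = tr((K^T X^{-1} K)^{-p}) for m×m real symmetric positive definite X, where the matrix power is taken via the spectral decomposition of the positive definite matrix K^T X^{-1} K. Then for every positive definite X, the set {H ∈ S^m : D²Φ_p(X)[H,H] = 0} is a linear subspace of S^m of dimension (m−k)(m−k+1)/2; equivalently, the Hessian of Φ_p at X, viewed as a linear map on the m(m+1)/2-dimensional space S^m, has rank m(m+1)/2 − (m−k)(m−k+1)/2. -/

import Mathlib

open Matrix

noncomputable section

/-- Real power of a Hermitian (here: real symmetric) matrix, defined through its spectral
decomposition.  (Junk value `0` on non-Hermitian input.) -/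
def mpow {k : ℕ} (Y : Matrix (Fin k) (Fin k) ℝ) (r : ℝ) : Matrix (Fin k) (Fin k) ℝ :=
  if h : Y.IsHermitian then
    (h.eigenvectorUnitary : Matrix (Fin k) (Fin k) ℝ) *
      Matrix.diagonal (fun i => h.eigenvalues i ^ r) *
      star (h.eigenvectorUnitary : Matrix (Fin k) (Fin k) ℝ)
  else 0

section helpers

open Filter Topology

/-- Spectral form of `mpow`. -/
lemma mpow_spec {k : ℕ} (Y : Matrix (Fin k) (Fin k) ℝ) (h : Y.IsHermitian) (r : ℝ) :
    ∃ (U : Matrix (Fin k) (Fin k) ℝ) (l : Fin k → ℝ), Uᵀ * U = 1 ∧ U * Uᵀ = 1 ∧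
      (∀ i j, U i j ∈ Set.Icc (-1 : ℝ) 1) ∧
      Y = U * diagonal l * Uᵀ ∧ mpow Y r = U * diagonal (fun i => l i ^ r) * Uᵀ ∧
      (Y.PosDef → ∀ i, 0 < l i) := by
  have hst : star (h.eigenvectorUnitary : Matrix (Fin k) (Fin k) ℝ) =
      (h.eigenvectorUnitary : Matrix (Fin k) (Fin k) ℝ)ᵀ := by
    rw [star_eq_conjTranspose, conjTranspose_eq_transpose_of_trivial]
  refine ⟨h.eigenvectorUnitary, h.eigenvalues, ?_, ?_, ?_, ?_, ?_, ?_⟩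
  · rw [← hst]; exact Unitary.coe_star_mul_self _
  · rw [← hst]; exact Unitary.coe_mul_star_self _
  · intro i j
    have := entry_norm_bound_of_unitary h.eigenvectorUnitary.2 i j
    rw [Real.norm_eq_abs, abs_le] at this
    exact this
  · conv_lhs => rw [h.spectral_theorem]
    rw [Unitary.conjStarAlgAut_apply, hst]
    rfl
  · rw [mpow, dif_pos h, hst]
  · intro hY i
    exact hY.eigenvalues_pos i

lemma matTendsto_mul {α : Type*} {l : Filter α} {a b c : ℕ}
    {A : α → Matrix (Fin a) (Fin b) ℝ} {B : α → Matrix (Fin b) (Fin c) ℝ}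
    {A0 : Matrix (Fin a) (Fin b) ℝ} {B0 : Matrix (Fin b) (Fin c) ℝ}
    (hA : Tendsto A l (𝓝 A0)) (hB : Tendsto B l (𝓝 B0)) :
    Tendsto (fun t => A t * B t) l (𝓝 (A0 * B0)) := by
  have hc : Continuous (fun q : Matrix (Fin a) (Fin b) ℝ × Matrix (Fin b) (Fin c) ℝ =>
      q.1 * q.2) := continuous_fst.matrix_mul continuous_snd
  exact (hc.tendsto (A0, B0)).comp (hA.prodMk_nhds hB)

lemma matTendsto_transpose {α : Type*} {l : Filter α} {a b : ℕ}
    {A : α → Matrix (Fin a) (Fin b) ℝ} {A0 : Matrix (Fin a) (Fin b) ℝ}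
    (hA : Tendsto A l (𝓝 A0)) : Tendsto (fun t => (A t)ᵀ) l (𝓝 A0ᵀ) :=
  ((continuous_id.matrix_transpose).tendsto A0).comp hA

lemma matTendsto_iff {α : Type*} {l : Filter α} {a b : ℕ}
    {A : α → Matrix (Fin a) (Fin b) ℝ} {A0 : Matrix (Fin a) (Fin b) ℝ} :
    Tendsto A l (𝓝 A0) ↔ ∀ i j, Tendsto (fun t => A t i j) l (𝓝 (A0 i j)) := by
  constructor
  · intro h i j
    exact tendsto_pi_nhds.1 (tendsto_pi_nhds.1 h i) j
  · intro h
    exact tendsto_pi_nhds.2 fun i => tendsto_pi_nhds.2 fun j => h i j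

/-- entrywise description of products with diagonal matrices in the middle -/
lemma diag_conj {k : ℕ} (V : Matrix (Fin k) (Fin k) ℝ) (l : Fin k → ℝ)
    (hV : Vᵀ * V = 1) (A : Matrix (Fin k) (Fin k) ℝ) (i j : Fin k) :
    (A * (V * diagonal l * Vᵀ) * V) i j = (A * V) i j * l j := by
  have : A * (V * diagonal l * Vᵀ) * V = (A * V) * diagonal l * (Vᵀ * V) := by
    simp only [Matrix.mul_assoc]
  rw [this, hV, Matrix.mul_one, mul_diagonal]

lemma conj_diag {k : ℕ} (U : Matrix (Fin k) (Fin k) ℝ) (l : Fin k → ℝ)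
    (hU : Uᵀ * U = 1) (A : Matrix (Fin k) (Fin k) ℝ) (i j : Fin k) :
    (Uᵀ * (U * diagonal l * Uᵀ) * A) i j = l i * (Uᵀ * A) i j := by
  have : Uᵀ * (U * diagonal l * Uᵀ) * A = (Uᵀ * U) * diagonal l * (Uᵀ * A) := by
    simp only [Matrix.mul_assoc]
  rw [this, hU, Matrix.one_mul, diagonal_mul]

/-- Daleckii-Krein derivative of the matrix power. -/
lemma mpow_deriv {k : ℕ} (r : ℝ) (Y : ℝ → Matrix (Fin k) (Fin k) ℝ)
    (hY : ∀ t, (Y t).IsHermitian) (Y0 Y' U : Matrix (Fin k) (Fin k) ℝ) (l : Fin k → ℝ)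
    (hU : Uᵀ * U = 1) (hU' : U * Uᵀ = 1) (hY0 : Y0 = U * diagonal l * Uᵀ)
    (hl : ∀ i, 0 < l i)
    (hlim : Tendsto Y (𝓝[≠] 0) (𝓝 Y0))
    (hder : Tendsto (fun t => t⁻¹ • (Y t - Y0)) (𝓝[≠] 0) (𝓝 Y')) :
    Tendsto (fun t => t⁻¹ • (mpow (Y t) r - U * diagonal (fun i => l i ^ r) * Uᵀ)) (𝓝[≠] 0)
      (𝓝 (U * (Matrix.of fun i j => dslope (fun x : ℝ => x ^ r) (l i) (l j) *
        (Uᵀ * Y' * U) i j) * Uᵀ)) := by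
  choose V mu hV hV' hVb hYV hpow _ using fun t => mpow_spec (Y t) (hY t) r
  rw [tendsto_iff_ultrafilter]
  intro 𝒰 h𝒰
  replace hlim := hlim.mono_left h𝒰
  replace hder := hder.mono_left h𝒰
  have hcomp : IsCompact {A : Matrix (Fin k) (Fin k) ℝ | ∀ i j, A i j ∈ Set.Icc (-1 : ℝ) 1} := by
    have h1 : IsCompact (Set.pi Set.univ fun _ : Fin k => Set.pi Set.univ
        fun _ : Fin k => Set.Icc (-1 : ℝ) 1) :=
      isCompact_univ_pi fun _ => isCompact_univ_pi fun _ => isCompact_Icc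
    have h2 : {A : Fin k → Fin k → ℝ | ∀ i j, A i j ∈ Set.Icc (-1 : ℝ) 1} =
        Set.pi Set.univ fun _ : Fin k => Set.pi Set.univ fun _ : Fin k => Set.Icc (-1 : ℝ) 1 := by
      ext A
      simp only [Set.mem_ofPred_eq, Set.mem_pi, Set.mem_univ, true_imp_iff]
    rw [← h2] at h1
    exact h1
  obtain ⟨V0, -, hV0⟩ := hcomp.ultrafilter_le_nhds (𝒰.map V) (by
    rw [le_principal_iff]
    exact Filter.mem_map.2 (Filter.univ_mem' hVb))
  replace hV0 : Tendsto V 𝒰 (𝓝 V0) := hV0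
  have hV0T := matTendsto_transpose hV0
  have hV0o : V0ᵀ * V0 = 1 := by
    refine tendsto_nhds_unique (matTendsto_mul hV0T hV0) ?_
    simp only [hV]
    exact tendsto_const_nhds
  have hV0o' : V0 * V0ᵀ = 1 := by
    refine tendsto_nhds_unique (matTendsto_mul hV0 hV0T) ?_
    simp only [hV']
    exact tendsto_const_nhds
  set mu0 : Fin k → ℝ := fun j => (V0ᵀ * Y0 * V0) j j with hmu0
  have hmu : ∀ j, Tendsto (fun t => mu t j) 𝒰 (𝓝 (mu0 j)) := by
    intro j
    have := matTendsto_iff.1 (matTendsto_mul (matTendsto_mul hV0T hlim) hV0) j j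
    refine this.congr fun t => ?_
    have h2 : ((V t)ᵀ * (Y t) * V t) j j = ((V t)ᵀ * V t) j j * mu t j := by
      conv_lhs => rw [hYV t]
      rw [diag_conj (V t) _ (hV t)]
    rw [h2, hV t]; simp
  have hW : ∀ i j, (Uᵀ * V0) i j * mu0 j = l i * (Uᵀ * V0) i j := by
    intro i j
    have h1 : Tendsto (fun t => (Uᵀ * Y t * V t) i j) 𝒰 (𝓝 ((Uᵀ * Y0 * V0) i j)) :=
      matTendsto_iff.1 (matTendsto_mul (matTendsto_mul tendsto_const_nhds hlim) hV0) i j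
    have h2 : Tendsto (fun t => (Uᵀ * V t) i j * mu t j) 𝒰 (𝓝 ((Uᵀ * V0) i j * mu0 j)) :=
      (matTendsto_iff.1 (matTendsto_mul tendsto_const_nhds hV0) i j).mul (hmu j)
    have h3 : (Uᵀ * Y0 * V0) i j = (Uᵀ * V0) i j * mu0 j := by
      refine tendsto_nhds_unique h1 (h2.congr fun t => ?_)
      conv_rhs => rw [hYV t]
      rw [diag_conj (V t) _ (hV t)]
    rw [← h3, hY0, conj_diag U l hU]
  have hmem : ∀ j, ∃ i, mu0 j = l i := by
    intro j
    by_contra hcon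
    push Not at hcon
    have h0 : ∀ i, (Uᵀ * V0) i j = 0 := by
      intro i
      have := hW i j
      have h4 : (Uᵀ * V0) i j * (mu0 j - l i) = 0 := by linarith
      exact (mul_eq_zero.1 h4).resolve_right (sub_ne_zero.2 (hcon i))
    have h5 : ((Uᵀ * V0)ᵀ * (Uᵀ * V0)) j j = 1 := by
      have : (Uᵀ * V0)ᵀ * (Uᵀ * V0) = V0ᵀ * (U * Uᵀ) * V0 := by
        rw [transpose_mul, transpose_transpose]; simp only [Matrix.mul_assoc]
      rw [this, hU', Matrix.mul_one, hV0o]; simp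
    rw [mul_apply] at h5
    simp [h0] at h5
  have hcont : ∀ i j, Tendsto (fun t => dslope (fun x : ℝ => x ^ r) (l i) (mu t j)) 𝒰
      (𝓝 (dslope (fun x : ℝ => x ^ r) (l i) (mu0 j))) := by
    intro i j
    suffices h : ContinuousAt (dslope (fun x : ℝ => x ^ r) (l i)) (mu0 j) from
      Tendsto.comp h (hmu j)
    obtain ⟨i', hi'⟩ := hmem j
    rw [hi']
    by_cases hii : l i' = l i
    · rw [hii, continuousAt_dslope_same]
      exact Real.differentiableAt_rpow_const_of_ne r (hl i).ne'
    · rw [continuousAt_dslope_of_ne hii]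
      exact Real.continuousAt_rpow_const _ _ (Or.inl (hl i').ne')
  have hmain : Tendsto (fun t => Uᵀ * (t⁻¹ • (mpow (Y t) r -
      U * diagonal (fun i => l i ^ r) * Uᵀ)) * V t) 𝒰 (𝓝 ((Matrix.of fun i j =>
        dslope (fun x : ℝ => x ^ r) (l i) (l j) * (Uᵀ * Y' * U) i j) * (Uᵀ * V0))) := by
    rw [matTendsto_iff]
    intro i j
    have h1 : Tendsto (fun t => dslope (fun x : ℝ => x ^ r) (l i) (mu t j) *
        (Uᵀ * (t⁻¹ • (Y t - Y0)) * V t) i j) 𝒰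
        (𝓝 (dslope (fun x : ℝ => x ^ r) (l i) (mu0 j) * (Uᵀ * Y' * V0) i j)) :=
      (hcont i j).mul
        (matTendsto_iff.1 (matTendsto_mul (matTendsto_mul tendsto_const_nhds hder) hV0) i j)
    have h2 : dslope (fun x : ℝ => x ^ r) (l i) (mu0 j) * (Uᵀ * Y' * V0) i j =
        ((Matrix.of fun i j =>
        dslope (fun x : ℝ => x ^ r) (l i) (l j) * (Uᵀ * Y' * U) i j) * (Uᵀ * V0)) i j := by
      have h3 : Uᵀ * Y' * V0 = (Uᵀ * Y' * U) * (Uᵀ * V0) := by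
        have : (Uᵀ * Y' * U) * (Uᵀ * V0) = Uᵀ * Y' * (U * Uᵀ) * V0 := by
          simp only [Matrix.mul_assoc]
        rw [this, hU', Matrix.mul_one]
      rw [h3, mul_apply, mul_apply, Finset.mul_sum]
      refine Finset.sum_congr rfl fun a _ => ?_
      rw [of_apply]
      by_cases h0 : (Uᵀ * V0) a j = 0
      · rw [h0]; ring
      · have : mu0 j = l a := by
          have := hW a j
          rw [mul_comm] at this
          exact mul_right_cancel₀ h0 this
        rw [this]; ring
    rw [← h2]
    refine h1.congr fun t => ?_
    have e1 : (Uᵀ * (t⁻¹ • (Y t - Y0)) * V t) i j =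
        t⁻¹ * ((Uᵀ * V t) i j * mu t j - l i * (Uᵀ * V t) i j) := by
      rw [Matrix.mul_smul, Matrix.smul_mul, Matrix.mul_sub, Matrix.sub_mul, Matrix.smul_apply, Matrix.sub_apply,
        hY0, conj_diag U l hU]
      conv_lhs => rw [hYV t]
      rw [diag_conj (V t) _ (hV t), smul_eq_mul]
    have e2 : (Uᵀ * (t⁻¹ • (mpow (Y t) r - U * diagonal (fun i => l i ^ r) * Uᵀ)) * V t) i j =
        t⁻¹ * ((Uᵀ * V t) i j * mu t j ^ r - l i ^ r * (Uᵀ * V t) i j) := by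
      rw [Matrix.mul_smul, Matrix.smul_mul, Matrix.mul_sub, Matrix.sub_mul, Matrix.smul_apply, Matrix.sub_apply,
        conj_diag U _ hU, hpow t,
        diag_conj (V t) _ (hV t), smul_eq_mul]
    rw [e1, e2]
    have := sub_smul_dslope (fun x : ℝ => x ^ r) (l i) (mu t j)
    simp only [smul_eq_mul] at this
    linear_combination (t⁻¹ * (Uᵀ * V t) i j) * this
  have hfin := matTendsto_mul (matTendsto_mul (tendsto_const_nhds (x := U)) hmain) hV0T
  have hL : ∀ M : Matrix (Fin k) (Fin k) ℝ, U * (M * (Uᵀ * V0)) * V0ᵀ = U * M * Uᵀ := by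
    intro M
    have : U * (M * (Uᵀ * V0)) * V0ᵀ = U * M * Uᵀ * (V0 * V0ᵀ) := by simp only [Matrix.mul_assoc]
    rw [this, hV0o', Matrix.mul_one]
  rw [hL] at hfin
  refine hfin.congr fun t => ?_
  have : ∀ M : Matrix (Fin k) (Fin k) ℝ, U * (Uᵀ * M * V t) * (V t)ᵀ = M := by
    intro M
    have : U * (Uᵀ * M * V t) * (V t)ᵀ = (U * Uᵀ) * M * (V t * (V t)ᵀ) := by
      simp only [Matrix.mul_assoc]
    rw [this, hU', hV', Matrix.mul_one, Matrix.one_mul]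
  exact this _

/-- positivity of the coefficients -/
lemma coeff_pos {r a b : ℝ} (hr : -1 < r) (ha : 0 < a) (hb : 0 < b) :
    0 < a ^ r / b + b ^ r / a + dslope (fun x : ℝ => x ^ r) a b := by
  by_cases hab : b = a
  · subst hab
    rw [dslope_same, Real.deriv_rpow_const, Real.rpow_sub hb, Real.rpow_one]
    have : 0 < b ^ r := Real.rpow_pos_of_pos hb r
    have h2 : b ^ r / b + b ^ r / b + r * (b ^ r / b) = (r + 2) * (b ^ r / b) := by ring
    rw [h2]
    have : 0 < b ^ r / b := by positivity
    exact mul_pos (by linarith) this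
  · rw [dslope_of_ne _ hab, slope_def_field]
    have hsub : b - a ≠ 0 := sub_ne_zero.2 hab
    have key : a ^ r / b + b ^ r / a + (b ^ r - a ^ r) / (b - a) =
        ((b ^ r * b ^ 2 - a ^ r * a ^ 2) / (b - a)) / (a * b) := by
      field_simp
      ring
    rw [key]
    have e : ∀ x : ℝ, 0 < x → x ^ r * x ^ 2 = x ^ (r + 2) := by
      intro x hx
      rw [Real.rpow_add hx]; norm_num
    rw [e a ha, e b hb]
    refine div_pos ?_ (mul_pos ha hb)
    rcases lt_or_gt_of_ne hab with h | h
    · exact div_pos_of_neg_of_neg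
        (sub_neg.2 (Real.rpow_lt_rpow hb.le h (by linarith))) (sub_neg.2 h)
    · exact div_pos (sub_pos.2 (Real.rpow_lt_rpow ha.le h (by linarith))) (sub_pos.2 h)

/-- The space of symmetric matrices annihilating an injective `A`. -/
lemma symm_ann_dim {m k : ℕ} (A : Matrix (Fin m) (Fin k) ℝ) (hA : A.rank = k) :
    ∃ V : Submodule ℝ (Matrix (Fin m) (Fin m) ℝ),
      (V : Set (Matrix (Fin m) (Fin m) ℝ)) = {H | H.IsSymm ∧ H * A = 0} ∧
      Module.finrank ℝ V = (m - k) * (m - k + 1) / 2 := by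
  have hdim : Module.finrank ℝ (LinearMap.ker Aᵀ.mulVecLin) = m - k := by
    have h1 := LinearMap.finrank_range_add_finrank_ker Aᵀ.mulVecLin
    have h2 : Module.finrank ℝ (LinearMap.range Aᵀ.mulVecLin) = k := by
      have := rank_transpose A
      rw [hA] at this
      exact this
    rw [h2, Module.finrank_fin_fun] at h1
    omega
  obtain ⟨n, hn⟩ : ∃ n, n = m - k := ⟨_, rfl⟩
  rw [← hn] at hdim ⊢
  have e : (Fin n → ℝ) ≃ₗ[ℝ] (LinearMap.ker Aᵀ.mulVecLin) :=
    LinearEquiv.ofFinrankEq _ _ (by rw [hdim, Module.finrank_fin_fun])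
  set ι : (Fin n → ℝ) →ₗ[ℝ] (Fin m → ℝ) :=
    (LinearMap.ker Aᵀ.mulVecLin).subtype ∘ₗ e.toLinearMap with hι
  have hιker : LinearMap.ker ι = ⊥ := by
    rw [LinearMap.ker_eq_bot]
    exact (Submodule.injective_subtype _).comp e.injective
  obtain ⟨g, hg⟩ := LinearMap.exists_leftInverse_of_injective ι hιker
  set P := LinearMap.toMatrix' ι with hP
  set L := LinearMap.toMatrix' g with hL
  have hLP : L * P = 1 := by
    rw [hP, hL, ← LinearMap.toMatrix'_comp, hg, LinearMap.toMatrix'_id]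
  have hAP : Aᵀ * P = 0 := by
    apply Matrix.ext_of_mulVec_single
    intro i
    rw [← mulVec_mulVec, hP, LinearMap.toMatrix'_mulVec, zero_mulVec]
    exact (e (Pi.single i 1)).2
  have hPL : ∀ v : Fin m → ℝ, Aᵀ *ᵥ v = 0 → P *ᵥ (L *ᵥ v) = v := by
    intro v hv
    rw [hP, hL, LinearMap.toMatrix'_mulVec, LinearMap.toMatrix'_mulVec]
    have : v = ι (e.symm ⟨v, hv⟩) := by simp [hι]
    rw [this]
    have h3 := LinearMap.congr_fun hg (e.symm ⟨v, hv⟩)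
    rw [LinearMap.comp_apply] at h3
    rw [h3]; rfl
  have hPLM : ∀ M : Matrix (Fin m) (Fin m) ℝ, Aᵀ * M = 0 → P * (L * M) = M := by
    intro M hM
    apply Matrix.ext_of_mulVec_single
    intro i
    rw [← mulVec_mulVec, ← mulVec_mulVec]
    apply hPL
    rw [mulVec_mulVec, hM, zero_mulVec]
  let S : (Sym2 (Fin n) → ℝ) →ₗ[ℝ] Matrix (Fin n) (Fin n) ℝ :=
    { toFun := fun f => Matrix.of fun i j => f s(i, j)
      map_add' := fun _ _ => rfl
      map_smul' := fun _ _ => rfl }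
  let T : (Sym2 (Fin n) → ℝ) →ₗ[ℝ] Matrix (Fin m) (Fin m) ℝ :=
    { toFun := fun f => P * S f * Pᵀ
      map_add' := fun x y => by rw [map_add, Matrix.mul_add, Matrix.add_mul]
      map_smul' := fun c x => by
        rw [map_smul, Matrix.mul_smul, Matrix.smul_mul]; rfl }
  have hTdef : ∀ f, T f = P * S f * Pᵀ := fun _ => rfl
  have hSsymm : ∀ f, (S f)ᵀ = S f := by
    intro f
    ext i j
    change f s(j, i) = f s(i, j)
    rw [Sym2.eq_swap]
  have hLPt : Pᵀ * Lᵀ = 1 := by rw [← transpose_mul, hLP, transpose_one]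
  have hTinj : Function.Injective T := by
    intro f f' h
    have h1 : ∀ f, L * T f * Lᵀ = S f := by
      intro f
      have : L * T f * Lᵀ = (L * P) * S f * (Pᵀ * Lᵀ) := by
        rw [hTdef]; simp only [Matrix.mul_assoc]
      rw [this, hLP, hLPt, Matrix.mul_one, Matrix.one_mul]
    have h2 : S f = S f' := by rw [← h1 f, ← h1 f', h]
    funext z
    induction z using Sym2.ind with
    | _ i j => exact congrFun (congrFun h2 i) j
  refine ⟨LinearMap.range T, ?_, ?_⟩
  · ext H
    simp only [SetLike.mem_coe, LinearMap.mem_range, Set.mem_ofPred_eq]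
    constructor
    · rintro ⟨f, rfl⟩
      constructor
      · rw [Matrix.IsSymm, hTdef, transpose_mul, transpose_mul, transpose_transpose, hSsymm,
          Matrix.mul_assoc]
      · have : Pᵀ * A = 0 := by
          have := congrArg transpose hAP
          rwa [transpose_mul, transpose_transpose, transpose_zero] at this
        rw [hTdef, Matrix.mul_assoc, this, Matrix.mul_zero]
    · rintro ⟨hs, h0⟩
      have hs' : Hᵀ = H := hs
      have h1 : Aᵀ * H = 0 := by
        have := congrArg transpose h0
        rwa [transpose_mul, hs', transpose_zero] at this
      have h2 := hPLM H h1
      have h3 : H = P * (L * H * Lᵀ) * Pᵀ := by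
        have h4 := congrArg transpose h2
        rw [transpose_mul, transpose_mul, hs'] at h4
        calc H = P * (L * H) := h2.symm
          _ = P * (L * (H * Lᵀ * Pᵀ)) := by rw [h4]
          _ = _ := by simp only [Matrix.mul_assoc]
      have h5 : (L * H * Lᵀ)ᵀ = L * H * Lᵀ := by
        rw [transpose_mul, transpose_mul, transpose_transpose, hs', Matrix.mul_assoc]
      refine ⟨fun z => Sym2.lift ⟨fun i j => (L * H * Lᵀ) i j, fun i j => ?_⟩ z, ?_⟩
      · exact (congrFun (congrFun h5 i) j).symm
      · rw [hTdef]
        conv_rhs => rw [h3]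
        rfl
  · rw [LinearMap.finrank_range_of_inj hTinj, Module.finrank_fintype_fun_eq_card, Sym2.card,
      Fintype.card_fin, Nat.choose_two_right, mul_comm]
    rfl

lemma md_tendsto {a b : ℕ} {F : ℝ → Matrix (Fin a) (Fin b) ℝ} {F0 F' : Matrix (Fin a) (Fin b) ℝ}
    (h : Tendsto (fun t : ℝ => t⁻¹ • (F t - F0)) (𝓝[≠] 0) (𝓝 F')) :
    Tendsto F (𝓝[≠] 0) (𝓝 F0) := by
  have h0 : Tendsto (fun t : ℝ => t) (𝓝[≠] 0) (𝓝 0) := nhdsWithin_le_nhds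
  have h1 := (h0.smul h).add (tendsto_const_nhds (x := F0))
  rw [zero_smul, zero_add] at h1
  refine h1.congr' ?_
  filter_upwards [self_mem_nhdsWithin] with t ht
  have ht' : t ≠ 0 := ht
  rw [smul_smul, mul_inv_cancel₀ ht', one_smul, sub_add_cancel]

lemma md_mul {a b c : ℕ} {F : ℝ → Matrix (Fin a) (Fin b) ℝ} {F0 F' : Matrix (Fin a) (Fin b) ℝ}
    {G : ℝ → Matrix (Fin b) (Fin c) ℝ} {G0 G' : Matrix (Fin b) (Fin c) ℝ}
    (hF : Tendsto (fun t : ℝ => t⁻¹ • (F t - F0)) (𝓝[≠] 0) (𝓝 F'))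
    (hG : Tendsto (fun t : ℝ => t⁻¹ • (G t - G0)) (𝓝[≠] 0) (𝓝 G')) :
    Tendsto (fun t : ℝ => t⁻¹ • (F t * G t - F0 * G0)) (𝓝[≠] 0) (𝓝 (F' * G0 + F0 * G')) := by
  refine ((matTendsto_mul hF (md_tendsto hG)).add
    (matTendsto_mul (tendsto_const_nhds (x := F0)) hG)).congr fun t => ?_
  rw [Matrix.smul_mul, Matrix.mul_smul, ← smul_add, Matrix.sub_mul, Matrix.mul_sub]
  congr 1
  abel

lemma md_const {a b : ℕ} (F0 : Matrix (Fin a) (Fin b) ℝ) :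
    Tendsto (fun t : ℝ => t⁻¹ • (F0 - F0)) (𝓝[≠] 0) (𝓝 0) := by
  simp

lemma md_inv {m : ℕ} (X H : Matrix (Fin m) (Fin m) ℝ) (hX : IsUnit X.det) :
    Tendsto (fun t : ℝ => t⁻¹ • ((X + t • H)⁻¹ - X⁻¹)) (𝓝[≠] 0) (𝓝 (-(X⁻¹ * H * X⁻¹))) := by
  have hXt : Tendsto (fun t : ℝ => X + t • H) (𝓝[≠] 0) (𝓝 X) := by
    have : Continuous (fun t : ℝ => X + t • H) := by fun_prop
    have h := this.tendsto 0
    rw [zero_smul, add_zero] at h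
    exact h.mono_left nhdsWithin_le_nhds
  have hdet : Tendsto (fun t : ℝ => (X + t • H).det) (𝓝[≠] 0) (𝓝 X.det) :=
    ((continuous_id.matrix_det).tendsto X).comp hXt
  have hinv : Tendsto (fun t : ℝ => (X + t • H)⁻¹) (𝓝[≠] 0) (𝓝 X⁻¹) := by
    have hadj : Tendsto (fun t : ℝ => (X + t • H).adjugate) (𝓝[≠] 0) (𝓝 X.adjugate) :=
      ((continuous_id.matrix_adjugate).tendsto X).comp hXt
    simp only [Matrix.inv_def, Ring.inverse_eq_inv']
    exact (hdet.inv₀ hX.ne_zero).smul hadj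
  have h1 := (matTendsto_mul (matTendsto_mul hinv (tendsto_const_nhds (x := H)))
    (tendsto_const_nhds (x := X⁻¹))).neg
  refine h1.congr' ?_
  filter_upwards [self_mem_nhdsWithin, hdet.eventually_ne hX.ne_zero] with t ht hd
  have ht' : t ≠ 0 := ht
  have hu : IsUnit (X + t • H).det := isUnit_iff_ne_zero.2 hd
  have h2 : (X + t • H)⁻¹ - X⁻¹ = -(t • ((X + t • H)⁻¹ * H * X⁻¹)) := by
    have e1 : (X + t • H)⁻¹ * (X + t • H) * X⁻¹ = X⁻¹ := by
      rw [nonsing_inv_mul _ hu, Matrix.one_mul]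
    have e2 : (X + t • H)⁻¹ * (X + t • H) * X⁻¹ =
        (X + t • H)⁻¹ + t • ((X + t • H)⁻¹ * H * X⁻¹) := by
      rw [Matrix.mul_add, Matrix.add_mul, Matrix.mul_assoc _ X, mul_nonsing_inv _ hX,
        Matrix.mul_one, Matrix.mul_smul, Matrix.smul_mul]
    rw [e2] at e1
    rw [sub_eq_iff_eq_add, eq_neg_add_iff_add_eq, add_comm]
    exact e1
  rw [h2, smul_neg, smul_smul, inv_mul_cancel₀ ht', one_smul]

lemma deriv_of_slope {f g : ℝ → ℝ} {c : ℝ} (hg : Tendsto g (𝓝[≠] 0) (𝓝 c))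
    (hfg : ∀ t, g t = t⁻¹ • (f (0 + t) - f 0)) : deriv f 0 = c :=
  (hasDerivAt_iff_tendsto_slope_zero.2 (hg.congr hfg)).deriv

/-- The second derivative, written out in an eigenbasis. -/
lemma second_deriv {m k : ℕ} (K : Matrix (Fin m) (Fin k) ℝ) (p : ℝ)
    (X : Matrix (Fin m) (Fin m) ℝ) (hX : X.PosDef) (H : Matrix (Fin m) (Fin m) ℝ)
    (hH : H.IsSymm) (U : Matrix (Fin k) (Fin k) ℝ) (l : Fin k → ℝ) (hU : Uᵀ * U = 1)
    (hU' : U * Uᵀ = 1) (hY : Kᵀ * X⁻¹ * K = U * diagonal l * Uᵀ) (hl : ∀ i, 0 < l i)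
    (hpow : mpow (Kᵀ * X⁻¹ * K) (-p - 1) = U * diagonal (fun i => l i ^ (-p - 1)) * Uᵀ) :
    deriv (fun t : ℝ =>
          p * ((X + t • H)⁻¹ * K * mpow (Kᵀ * (X + t • H)⁻¹ * K) (-p - 1) * Kᵀ *
            (X + t • H)⁻¹ * H).trace) 0 =
      (-p) * (2 * ∑ i, l i ^ (-p - 1) * ((X⁻¹ * K * U)ᵀ * H * X⁻¹ * H * (X⁻¹ * K * U)) i i +
        ∑ i, ∑ j, dslope (fun x : ℝ => x ^ (-p - 1)) (l i) (l j) *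
          (((X⁻¹ * K * U)ᵀ * H * (X⁻¹ * K * U)) i j) ^ 2) := by
  have hXs : Xᵀ = X := by
    have := hX.1
    rwa [Matrix.IsHermitian, conjTranspose_eq_transpose_of_trivial] at this
  have hHs : Hᵀ = H := hH
  have hXu : IsUnit X.det := hX.det_pos.ne'.isUnit
  have hZs : (X⁻¹)ᵀ = X⁻¹ := by rw [transpose_nonsing_inv, hXs]
  have hZ := md_inv X H hXu
  have hYt := md_mul (md_mul (md_const Kᵀ) hZ) (md_const K)
  have hherm : ∀ t : ℝ, (Kᵀ * (X + t • H)⁻¹ * K).IsHermitian := by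
    intro t
    rw [Matrix.IsHermitian, conjTranspose_eq_transpose_of_trivial, transpose_mul, transpose_mul,
      transpose_transpose, transpose_nonsing_inv, transpose_add, transpose_smul, hXs, hHs,
      Matrix.mul_assoc]
  have hN := mpow_deriv (-p - 1) (fun t => Kᵀ * (X + t • H)⁻¹ * K) hherm _ _ U l hU hU' hY hl
    (md_tendsto hYt) hYt
  rw [← hpow] at hN
  have hT := md_mul (md_mul (md_mul (md_mul (md_mul hZ (md_const K)) hN) (md_const Kᵀ)) hZ)
    (md_const H)
  have hT2 := (((continuous_id.matrix_trace).tendsto _).comp hT).const_mul p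
  have hD := deriv_of_slope (f := fun t : ℝ =>
          p * ((X + t • H)⁻¹ * K * mpow (Kᵀ * (X + t • H)⁻¹ * K) (-p - 1) * Kᵀ *
            (X + t • H)⁻¹ * H).trace) hT2 (fun t => by
    simp only [zero_add, zero_smul, add_zero, Function.comp, id, trace_smul, trace_sub,
      smul_eq_mul]
    ring)
  rw [hD, hpow]
  set Z := X⁻¹ with hZdef
  set D := diagonal (fun i => l i ^ (-p - 1)) with hDdef
  set b := (Z * K * U)ᵀ * H * (Z * K * U) with hb
  have hbT : bᵀ = b := by
    rw [hb]
    simp only [transpose_mul, transpose_transpose, hHs, hZs, Matrix.mul_assoc]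
  have hY' : Uᵀ * (((0 : Matrix (Fin k) (Fin m) ℝ) * Z + Kᵀ * -(Z * H * Z)) * K +
      Kᵀ * Z * (0 : Matrix (Fin m) (Fin k) ℝ)) * U = -b := by
    rw [hb]
    simp only [transpose_mul, hZs, Matrix.mul_assoc, Matrix.mul_neg, Matrix.neg_mul,
      Matrix.zero_mul, Matrix.mul_zero, add_zero, zero_add]
  rw [hY']
  set R := Matrix.of (fun i j => dslope (fun x : ℝ => x ^ (-p - 1)) (l i) (l j) * (-b) i j)
    with hR
  simp only [Matrix.mul_zero, Matrix.zero_mul, add_zero, zero_add, id]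
  have e1 : ((((-(Z * H * Z) * K) * (U * D * Uᵀ) + Z * K * (U * R * Uᵀ)) * Kᵀ * Z +
      Z * K * (U * D * Uᵀ) * Kᵀ * -(Z * H * Z)) * H).trace =
      -2 * (D * ((Z * K * U)ᵀ * H * Z * H * (Z * K * U))).trace + (R * b).trace := by
    have t1 : (Z * H * Z * K * (U * D * Uᵀ) * Kᵀ * Z * H).trace =
        (D * ((Z * K * U)ᵀ * H * Z * H * (Z * K * U))).trace := by
      have : Z * H * Z * K * (U * D * Uᵀ) * Kᵀ * Z * H =
        (Z * H * Z * K * U) * (D * Uᵀ * Kᵀ * Z * H) := by simp only [Matrix.mul_assoc]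
      rw [this, trace_mul_comm]
      congr 1
      simp only [transpose_mul, hZs, Matrix.mul_assoc]
    have t2 : (Z * K * (U * D * Uᵀ) * Kᵀ * (Z * H * Z) * H).trace =
        (D * ((Z * K * U)ᵀ * H * Z * H * (Z * K * U))).trace := by
      have : Z * K * (U * D * Uᵀ) * Kᵀ * (Z * H * Z) * H =
        (Z * K * U) * (D * Uᵀ * Kᵀ * (Z * H * Z) * H) := by simp only [Matrix.mul_assoc]
      rw [this, trace_mul_comm]
      congr 1
      simp only [transpose_mul, hZs, Matrix.mul_assoc]
    have t3 : (Z * K * (U * R * Uᵀ) * Kᵀ * Z * H).trace = (R * b).trace := by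
      have : Z * K * (U * R * Uᵀ) * Kᵀ * Z * H =
        (Z * K * U) * (R * Uᵀ * Kᵀ * Z * H) := by simp only [Matrix.mul_assoc]
      rw [this, trace_mul_comm, hb]
      congr 1
      simp only [transpose_mul, hZs, Matrix.mul_assoc]
    simp only [Matrix.add_mul, Matrix.neg_mul, Matrix.mul_neg, trace_add, trace_neg]
    rw [t1, t2, t3]
    ring
  rw [e1]
  have e2 : ∀ M : Matrix (Fin k) (Fin k) ℝ,
      (D * M).trace = ∑ i, l i ^ (-p - 1) * M i i := by
    intro M
    simp [hDdef, Matrix.trace, diagonal_mul]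
  have e3 : (R * b).trace = -∑ i, ∑ j, dslope (fun x : ℝ => x ^ (-p - 1)) (l i) (l j) *
      b i j ^ 2 := by
    rw [Matrix.trace, ← Finset.sum_neg_distrib]
    refine Finset.sum_congr rfl fun i _ => ?_
    rw [diag_apply, mul_apply, ← Finset.sum_neg_distrib]
    refine Finset.sum_congr rfl fun j _ => ?_
    have : b j i = b i j := congrFun (congrFun hbT i) j
    rw [hR, of_apply, this, Matrix.neg_apply]
    ring
  rw [e2, e3]
  ring

lemma hessian_zero_iff {m k : ℕ} (K : Matrix (Fin m) (Fin k) ℝ) (hK : Function.Injective K.mulVec)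
    (p : ℝ) (hp : p < 0)
    (X : Matrix (Fin m) (Fin m) ℝ) (hX : X.PosDef) (H : Matrix (Fin m) (Fin m) ℝ)
    (hH : H.IsSymm) :
    deriv (fun t : ℝ =>
          p * ((X + t • H)⁻¹ * K * mpow (Kᵀ * (X + t • H)⁻¹ * K) (-p - 1) * Kᵀ *
            (X + t • H)⁻¹ * H).trace) 0 = 0 ↔ H * (X⁻¹ * K) = 0 := by
  have hXs : Xᵀ = X := by
    have := hX.1
    rwa [Matrix.IsHermitian, conjTranspose_eq_transpose_of_trivial] at this
  have hHs : Hᵀ = H := hH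
  have hZs : (X⁻¹)ᵀ = X⁻¹ := by rw [transpose_nonsing_inv, hXs]
  have hZ : (X⁻¹).PosDef := hX.inv
  have hY : (Kᵀ * X⁻¹ * K).PosDef := by
    have := hZ.conjTranspose_mul_mul_same hK
    rwa [conjTranspose_eq_transpose_of_trivial] at this
  obtain ⟨U, l, hU, hU', -, hYU, hpow, hl⟩ := mpow_spec _ hY.1 (-p - 1)
  replace hl := hl hY
  rw [second_deriv K p X hX H hH U l hU hU' hYU hl hpow]
  set Z := X⁻¹ with hZdef
  set A := Z * K * U with hA
  have hHA : H * (Z * K) = 0 ↔ H * A = 0 := by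
    constructor
    · intro h
      rw [hA, ← Matrix.mul_assoc, h, Matrix.zero_mul]
    · intro h
      have : H * (Z * K) = H * A * Uᵀ := by
        have : H * A * Uᵀ = H * (Z * K) * (U * Uᵀ) := by rw [hA]; simp only [Matrix.mul_assoc]
        rw [this, hU', Matrix.mul_one]
      rw [this, h, Matrix.zero_mul]
  rw [hHA]
  set b := Aᵀ * H * A with hb
  have hbT : bᵀ = b := by
    rw [hb]
    simp only [transpose_mul, transpose_transpose, hHs, Matrix.mul_assoc]
  have hbs : ∀ i j, b j i = b i j := fun i j => congrFun (congrFun hbT i) j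
  constructor
  swap
  · intro h
    have h1 : b = 0 := by rw [hb, Matrix.mul_assoc, h, Matrix.mul_zero]
    have h2 : Aᵀ * H * Z * H * A = 0 := by rw [Matrix.mul_assoc, h, Matrix.mul_zero]
    rw [h1, h2]
    simp
  intro h
  set Li : Matrix (Fin k) (Fin k) ℝ := diagonal (fun i => (l i)⁻¹) with hLi
  set T := H * A - K * U * Li * b with hT
  have hUYU : Uᵀ * Kᵀ * Z * K * U = diagonal l := by
    have : Uᵀ * Kᵀ * Z * K * U = Uᵀ * (Kᵀ * Z * K) * U := by simp only [Matrix.mul_assoc]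
    rw [this, hYU]
    have : Uᵀ * (U * diagonal l * Uᵀ) * U = (Uᵀ * U) * diagonal l * (Uᵀ * U) := by
      simp only [Matrix.mul_assoc]
    rw [this, hU, Matrix.one_mul, Matrix.mul_one]
  have hLl : Li * diagonal l = 1 := by
    rw [hLi, diagonal_mul_diagonal, ← diagonal_one]
    congr 1
    funext i
    exact inv_mul_cancel₀ (hl i).ne'
  have hLiT : Liᵀ = Li := diagonal_transpose _
  have hAT : Aᵀ = Uᵀ * Kᵀ * Z := by
    rw [hA]; simp only [transpose_mul, hZs, Matrix.mul_assoc]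
  have hC : Aᵀ * H * Z * H * A = Tᵀ * Z * T + b * Li * b := by
    have hTT : Tᵀ = Aᵀ * H - b * Li * (Uᵀ * Kᵀ) := by
      rw [hT]
      simp only [transpose_sub, transpose_mul, hHs, hbT, hLiT, Matrix.mul_assoc]
    have c1 : Aᵀ * H * Z * (K * U * Li * b) = b * Li * b := by
      have : Aᵀ * H * Z * (K * U * Li * b) = (Aᵀ * H * (Z * K * U)) * Li * b := by
        simp only [Matrix.mul_assoc]
      rw [this]
    have c2 : b * Li * (Uᵀ * Kᵀ) * Z * (H * A) = b * Li * b := by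
      have : b * Li * (Uᵀ * Kᵀ) * Z * (H * A) = b * Li * ((Uᵀ * Kᵀ * Z) * H * A) := by
        simp only [Matrix.mul_assoc]
      rw [this, ← hAT]
    have c3 : b * Li * (Uᵀ * Kᵀ) * Z * (K * U * Li * b) = b * Li * b := by
      have : b * Li * (Uᵀ * Kᵀ) * Z * (K * U * Li * b) =
          b * (Li * (Uᵀ * Kᵀ * Z * K * U)) * Li * b := by
        simp only [Matrix.mul_assoc]
      rw [this, hUYU, hLl, Matrix.mul_one]
    have c4 : Aᵀ * H * Z * (H * A) = Aᵀ * H * Z * H * A := by simp only [Matrix.mul_assoc]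
    rw [hTT]
    conv_rhs => rw [hT]
    rw [Matrix.sub_mul, Matrix.sub_mul, Matrix.mul_sub, Matrix.mul_sub, c1, c2, c3, c4]
    abel
  have hs : ∀ i, (Tᵀ * Z * T) i i = (fun a => T a i) ⬝ᵥ (Z *ᵥ (fun a => T a i)) := by
    intro i
    rw [Matrix.mul_assoc]
    simp only [mul_apply, dotProduct, mulVec, transpose_apply]
  have hs0 : ∀ i, 0 ≤ (Tᵀ * Z * T) i i := by
    intro i
    rw [hs]
    have := hZ.posSemidef.dotProduct_mulVec_nonneg (fun a => T a i)
    simpa using this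
  have hbb : ∀ i, (b * Li * b) i i = ∑ j, b i j ^ 2 / l j := by
    intro i
    rw [mul_apply]
    refine Finset.sum_congr rfl fun j _ => ?_
    rw [hLi, mul_diagonal, hbs i j]
    rw [div_eq_mul_inv]; ring
  have hlr : ∀ i, 0 < l i ^ (-p - 1) := fun i => Real.rpow_pos_of_pos (hl i) _
  have hr : -1 < -p - 1 := by linarith
  have hsum : 2 * ∑ i, l i ^ (-p - 1) * (Aᵀ * H * Z * H * A) i i +
        ∑ i, ∑ j, dslope (fun x : ℝ => x ^ (-p - 1)) (l i) (l j) * b i j ^ 2 =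
      2 * ∑ i, l i ^ (-p - 1) * (Tᵀ * Z * T) i i +
        ∑ i, ∑ j, (l i ^ (-p - 1) / l j + l j ^ (-p - 1) / l i +
          dslope (fun x : ℝ => x ^ (-p - 1)) (l i) (l j)) * b i j ^ 2 := by
    have d1 : ∑ i, l i ^ (-p - 1) * (Aᵀ * H * Z * H * A) i i =
        ∑ i, l i ^ (-p - 1) * (Tᵀ * Z * T) i i +
          ∑ i, ∑ j, l i ^ (-p - 1) / l j * b i j ^ 2 := by
      rw [← Finset.sum_add_distrib]
      refine Finset.sum_congr rfl fun i _ => ?_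
      rw [hC, Matrix.add_apply, hbb, mul_add, Finset.mul_sum]
      congr 1
      refine Finset.sum_congr rfl fun j _ => ?_
      ring
    have d2 : ∑ i, ∑ j, l j ^ (-p - 1) / l i * b i j ^ 2 =
        ∑ i, ∑ j, l i ^ (-p - 1) / l j * b i j ^ 2 := by
      rw [Finset.sum_comm]
      refine Finset.sum_congr rfl fun i _ => Finset.sum_congr rfl fun j _ => ?_
      rw [hbs]
    simp only [add_mul, Finset.sum_add_distrib]
    rw [d1, d2]
    ring
  rw [hsum] at h
  have h0 := (mul_eq_zero.1 h).resolve_left (by linarith)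
  have n1 : 0 ≤ ∑ i, l i ^ (-p - 1) * (Tᵀ * Z * T) i i :=
    Finset.sum_nonneg fun i _ => mul_nonneg (hlr i).le (hs0 i)
  have hterm : ∀ i j, 0 ≤ (l i ^ (-p - 1) / l j + l j ^ (-p - 1) / l i +
          dslope (fun x : ℝ => x ^ (-p - 1)) (l i) (l j)) * b i j ^ 2 := fun i j =>
    mul_nonneg (coeff_pos hr (hl i) (hl j)).le (sq_nonneg _)
  have n2 : 0 ≤ ∑ i, ∑ j, (l i ^ (-p - 1) / l j + l j ^ (-p - 1) / l i +
          dslope (fun x : ℝ => x ^ (-p - 1)) (l i) (l j)) * b i j ^ 2 :=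
    Finset.sum_nonneg fun i _ => Finset.sum_nonneg fun j _ => hterm i j
  have z1 : ∑ i, l i ^ (-p - 1) * (Tᵀ * Z * T) i i = 0 := by linarith
  have z2 : ∑ i, ∑ j, (l i ^ (-p - 1) / l j + l j ^ (-p - 1) / l i +
          dslope (fun x : ℝ => x ^ (-p - 1)) (l i) (l j)) * b i j ^ 2 = 0 := by linarith
  have hb0 : b = 0 := by
    ext i j
    rw [Finset.sum_eq_zero_iff_of_nonneg fun i _ => Finset.sum_nonneg fun j _ => hterm i j] at z2
    have z3 := z2 i (Finset.mem_univ _)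
    rw [Finset.sum_eq_zero_iff_of_nonneg fun j _ => hterm i j] at z3
    have z4 := z3 j (Finset.mem_univ _)
    have z5 := (mul_eq_zero.1 z4).resolve_left (coeff_pos hr (hl i) (hl j)).ne'
    exact pow_eq_zero_iff (two_ne_zero) |>.1 z5
  have hT0 : T = 0 := by
    ext a i
    rw [Finset.sum_eq_zero_iff_of_nonneg fun i _ => mul_nonneg (hlr i).le (hs0 i)] at z1
    have z3 := (mul_eq_zero.1 (z1 i (Finset.mem_univ _))).resolve_left (hlr i).ne'
    rw [hs] at z3
    by_contra hne
    have hv : (fun a => T a i) ≠ 0 := fun h => hne (congrFun h a)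
    have := hZ.dotProduct_mulVec_pos hv
    rw [star_trivial, z3] at this
    exact lt_irrefl _ this
  rw [hT, hb0, Matrix.mul_zero, sub_zero] at hT0
  exact hT0

end helpers

/-- The null space of the Hessian of `Φ_p(X) = tr ((Kᵀ X⁻¹ K)^{-p})` at a symmetric positive
definite `X`, i.e., the set of symmetric `H` with `D²Φ_p(X)[H,H] = 0` (where
`D²Φ_p(X)[H,H]` is the derivative at `0` of `t ↦ DΦ_p(X + tH)[H]`), is a linear subspace of
`S^m` of dimension `(m-k)(m-k+1)/2`; equivalently the Hessian has rank
`m(m+1)/2 - (m-k)(m-k+1)/2`. -/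
theorem pth_mean_hessian_nullspace_dim (m k : ℕ) (hm : 1 ≤ m) (hk : 1 ≤ k) (hkm : k ≤ m)
    (K : Matrix (Fin m) (Fin k) ℝ) (hK : K.rank = k) (p : ℝ) (hp : p < 0)
    (X : Matrix (Fin m) (Fin m) ℝ) (hX : X.PosDef) :
    ∃ V : Submodule ℝ (Matrix (Fin m) (Fin m) ℝ),
      (V : Set (Matrix (Fin m) (Fin m) ℝ)) =
        {H | H.IsSymm ∧ deriv (fun t : ℝ =>
          p * ((X + t • H)⁻¹ * K * mpow (Kᵀ * (X + t • H)⁻¹ * K) (-p - 1) * Kᵀ *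
            (X + t • H)⁻¹ * H).trace) 0 = 0} ∧
      Module.finrank ℝ V = (m - k) * (m - k + 1) / 2 := by
  have hKinj : Function.Injective K.mulVec := by
    have h1 := LinearMap.finrank_range_add_finrank_ker K.mulVecLin
    have h2 : Module.finrank ℝ (LinearMap.range K.mulVecLin) = k := hK
    rw [h2, Module.finrank_fin_fun] at h1
    have h3 : Module.finrank ℝ (LinearMap.ker K.mulVecLin) = 0 := by omega
    rw [Submodule.finrank_eq_zero, LinearMap.ker_eq_bot] at h3
    exact h3
  have hXu : IsUnit X.det := hX.det_pos.ne'.isUnit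
  have hrank : (X⁻¹ * K).rank = k := by
    rw [Matrix.rank_mul_eq_right_of_isUnit_det _ _ (Matrix.isUnit_nonsing_inv_det _ hXu), hK]
  obtain ⟨V, hV, hdim⟩ := symm_ann_dim (X⁻¹ * K) hrank
  refine ⟨V, ?_, hdim⟩
  rw [hV]
  ext H
  exact and_congr_right fun hH => (hessian_zero_iff K hKinj p hp X hX H hH).symm
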